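/- Characterisation of Kronecker pencils: the following are equivalent: (1) rank B = r and rank(A + λB) = r for every λ ∈ ℂ; (2) 2·dim L = 2·dim V − r, i.e., L is bi-Lagrangian; (3) V has exactly one bi-Lagrangian subspace. -/

import Mathlib

/-- The rank of a bilinear form `C` on `V`: `dim V - dim (ker C)`. -/
noncomputable def formRank {V : Type*} [AddCommGroup V] [Module ℂ V]
    (C : V →ₗ[ℂ] V →ₗ[ℂ] ℂ) : ℕ :=
  Module.finrank ℂ V - Module.finrank ℂ (LinearMap.ker C)

/-- A subspace `U` is bi-Lagrangian for a pencil of alternating forms `A + λB` of rank `r`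
if it is isotropic for both `A` and `B` and `2 · dim U = 2 · dim V − r`. -/
def IsBiLagrangian {V : Type*} [AddCommGroup V] [Module ℂ V]
    (A B : V →ₗ[ℂ] V →ₗ[ℂ] ℂ) (r : ℕ) (U : Submodule ℂ V) : Prop :=
  (∀ u ∈ U, ∀ u' ∈ U, A u u' = 0 ∧ B u u' = 0) ∧
    2 * Module.finrank ℂ U = 2 * Module.finrank ℂ V - r

open Module

lemma kp_norm {E : Type*} [AddCommGroup E] [Module ℂ E] [FiniteDimensional ℂ E]
    (T : E →ₗ[ℂ] E) (f : E →ₗ[ℂ] ℂ) :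
    ∃ (N : E → ℝ) (K F : ℝ), 0 ≤ K ∧ 0 ≤ F ∧ (∀ x, 0 ≤ N x) ∧ (∀ x, N x = 0 → x = 0) ∧
      (∀ (s : ℂ) x, N (s • x) = ‖s‖ * N x) ∧ (∀ x y, N (x - y) ≤ N x + N y) ∧
      (∀ x, N (T x) ≤ K * N x) ∧ (∀ x, ‖f x‖ ≤ F * N x) := by
  let e := (Module.finBasis ℂ E).equivFun
  let T' : (Fin (finrank ℂ E) → ℂ) →L[ℂ] (Fin (finrank ℂ E) → ℂ) :=
    LinearMap.toContinuousLinearMap (e.toLinearMap ∘ₗ T ∘ₗ e.symm.toLinearMap)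
  let f' : (Fin (finrank ℂ E) → ℂ) →L[ℂ] ℂ :=
    LinearMap.toContinuousLinearMap (f ∘ₗ e.symm.toLinearMap)
  refine ⟨fun x => ‖e x‖, ‖T'‖, ‖f'‖, norm_nonneg _, norm_nonneg _, fun x => norm_nonneg _,
    ?_, ?_, ?_, ?_, ?_⟩
  · intro x hx
    simpa using hx
  · intro s x
    simp only [map_smul, norm_smul]
  · intro x y
    simp only [map_sub]
    exact norm_sub_le _ _
  · intro x
    have := T'.le_opNorm (e x)
    simpa [T'] using this
  · intro x
    have := f'.le_opNorm (e x)
    simpa [f'] using this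

lemma kp_inj {E : Type*} [AddCommGroup E] [Module ℂ E] [FiniteDimensional ℂ E]
    (T : E →ₗ[ℂ] E) :
    ∃ R : ℝ, ∀ s : ℂ, R < ‖s‖ → ∀ x, s • x + T x = 0 → x = 0 := by
  obtain ⟨N, K, F, hK, hF, h0, h1, h2, h3, h4, h5⟩ := kp_norm T 0
  refine ⟨K, fun s hs x hx => h1 x ?_⟩
  have e : T x = (-s) • x := by
    rw [neg_smul]; exact eq_neg_of_add_eq_zero_right hx
  have := h4 x
  rw [e, h2, norm_neg] at this
  have := h0 x
  nlinarith

lemma kp_const {E : Type*} [AddCommGroup E] [Module ℂ E] [FiniteDimensional ℂ E]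
    (T : E →ₗ[ℂ] E) (f : E →ₗ[ℂ] ℂ) (w : E) (c : ℂ) (R : ℝ)
    (h : ∀ s : ℂ, R < ‖s‖ → ∃ x, s • x + T x = w ∧ f x = c) : c = 0 := by
  obtain ⟨N, K, F, hK, hF, h0, h1, h2, h3, h4, h5⟩ := kp_norm T f
  by_contra hc
  have hc' : 0 < ‖c‖ := norm_pos_iff.mpr hc
  set t : ℝ := |R| + K + 1 + F * N w / ‖c‖ with ht
  have hq : 0 ≤ F * N w / ‖c‖ := by have := h0 w; positivity
  have ht0 : 0 < t := by have := abs_nonneg R; linarith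
  have htn : ‖(t : ℂ)‖ = t := by simp [abs_of_pos ht0]
  obtain ⟨x, hx, hfx⟩ := h t (by rw [htn]; have := le_abs_self R; linarith)
  have e : (t : ℂ) • x = w - T x := eq_sub_of_add_eq hx
  have a1 := h3 w (T x)
  rw [← e, h2, htn] at a1
  have a2 := h4 x
  have a3 := h5 x
  rw [hfx] at a3
  have a4 : F * N w / ‖c‖ * ‖c‖ = F * N w := div_mul_cancel₀ _ hc'.ne'
  have a5 : (t - K) * N x ≤ N w := by nlinarith
  have a6 : (t - K) * ‖c‖ ≤ F * N w := by
    have : 0 ≤ t - K := by have := abs_nonneg R; linarith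
    nlinarith
  have a7 : (t - K) * ‖c‖ = (|R| + 1) * ‖c‖ + F * N w := by
    rw [← a4, ht]; ring
  have := abs_nonneg R
  nlinarith

lemma kp_limit {V : Type*} [AddCommGroup V] [Module ℂ V] [FiniteDimensional ℂ V]
    (G H : V →ₗ[ℂ] V →ₗ[ℂ] ℂ) (hG : ∀ v w, G v w = - G w v)
    (hmax : ∀ ε : ℂ, finrank ℂ (LinearMap.ker G) ≤ finrank ℂ (LinearMap.ker (G + ε • H)))
    (u : V) (hu : G u = 0) (f : V →ₗ[ℂ] ℂ)
    (hf : ∀ ε : ℂ, ε ≠ 0 →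
      finrank ℂ (LinearMap.ker (G + ε • H)) = finrank ℂ (LinearMap.ker G) →
      ∀ w, (G + ε • H) w = 0 → f w = 0) : f u = 0 := by
  obtain ⟨C, hC⟩ := Submodule.exists_isCompl (LinearMap.ker G)
  let res : (V →ₗ[ℂ] ℂ) →ₗ[ℂ] (C →ₗ[ℂ] ℂ) := LinearMap.lcomp ℂ ℂ C.subtype
  have hres : ∀ φ c, res φ c = φ c := fun φ c => rfl
  let a : C →ₗ[ℂ] (C →ₗ[ℂ] ℂ) := res ∘ₗ G ∘ₗ C.subtype
  have ha : Function.Injective a := by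
    rw [injective_iff_map_eq_zero]
    intro c hc
    have h1 : G c = 0 := by
      ext v
      have hv : v ∈ LinearMap.ker G ⊔ C := by rw [hC.sup_eq_top]; trivial
      obtain ⟨x, hx, y, hy, rfl⟩ := Submodule.mem_sup.1 hv
      have h2 : G c y = 0 := by
        have := congrArg (fun φ => φ ⟨y, hy⟩) hc
        exact this
      have h3 : G x = 0 := hx
      rw [map_add, h2, hG, h3]; simp
    have : (c : V) ∈ LinearMap.ker G ⊓ C := ⟨h1, c.2⟩
    rw [hC.inf_eq_bot] at this
    exact Subtype.ext this
  have hdim : finrank ℂ C = finrank ℂ (C →ₗ[ℂ] ℂ) := (Subspace.dual_finrank_eq).symm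
  let ae : C ≃ₗ[ℂ] (C →ₗ[ℂ] ℂ) := LinearEquiv.ofInjectiveOfFinrankEq a ha hdim
  have hae : ∀ c, ae c = a c := fun c => rfl
  let T : V →ₗ[ℂ] C := ae.symm.toLinearMap ∘ₗ res ∘ₗ H
  have hT : ∀ v, a (T v) = res (H v) := by
    intro v
    rw [← hae]; simp [T]
  let T0 : C →ₗ[ℂ] C := T ∘ₗ C.subtype
  have hCK : finrank ℂ (LinearMap.ker G) + finrank ℂ C = finrank ℂ V :=
    Submodule.finrank_add_eq_of_isCompl hC
  obtain ⟨R, hR⟩ := kp_inj T0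
  have key : - f u = 0 := by
    refine kp_const T0 (f ∘ₗ C.subtype) (- T u) (- f u) (max R 0) ?_
    intro s hs
    have hs0 : s ≠ 0 := by
      rintro rfl
      simp at hs
    have hinj : Function.Injective (s • LinearMap.id + T0 : C →ₗ[ℂ] C) := by
      rw [injective_iff_map_eq_zero]
      intro x hx
      exact hR s (lt_of_le_of_lt (le_max_left _ _) hs) x (by simpa using hx)
    obtain ⟨c, hc⟩ := (LinearMap.injective_iff_surjective.1 hinj) (- T u)
    have hc' : s • c + T0 c = - T u := by simpa using hc
    refine ⟨c, hc', ?_⟩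
    set G' := G + s⁻¹ • H with hG'
    have resG' : ∀ c : C, res (G' c) = a (s⁻¹ • (s • c + T0 c)) := by
      intro c
      have : T0 c = T c := rfl
      rw [smul_add, smul_smul, inv_mul_cancel₀ hs0, one_smul, map_add, map_smul, this, hT]
      simp [hG', a]
    have inj' : ∀ c : C, res (G' c) = 0 → c = 0 := by
      intro c hc
      rw [resG'] at hc
      have h1 := (injective_iff_map_eq_zero a).1 ha _ hc
      have h2 : s • c + T0 c = 0 := by
        rcases smul_eq_zero.1 h1 with h | h
        · exact absurd h (inv_ne_zero hs0)
        · exact h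
      exact hR s (lt_of_le_of_lt (le_max_left _ _) hs) c h2
    have disj : Disjoint (LinearMap.ker G') C := by
      rw [Submodule.disjoint_def]
      intro x hx hxC
      have := inj' ⟨x, hxC⟩ (by
        have : G' x = 0 := hx
        simp [this])
      simpa using congrArg Subtype.val this
    have hm := hmax s⁻¹
    rw [← hG'] at hm
    have hle : finrank ℂ (LinearMap.ker G') + finrank ℂ C ≤ finrank ℂ V :=
      Submodule.finrank_add_finrank_le_of_disjoint disj
    have heq : finrank ℂ (LinearMap.ker G') = finrank ℂ (LinearMap.ker G) := by omega
    have hsup : LinearMap.ker G' ⊔ C = ⊤ := by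
      apply Submodule.eq_top_of_finrank_eq
      have := Submodule.finrank_sup_add_finrank_inf_eq (LinearMap.ker G') C
      rw [disj.eq_bot, finrank_bot] at this
      omega
    have hw : G' (u + c) = 0 := by
      have hv : u + (c : V) ∈ LinearMap.ker G' ⊔ C := by rw [hsup]; trivial
      obtain ⟨x, hx, y, hy, hxy⟩ := Submodule.mem_sup.1 hv
      have hx : G' x = 0 := hx
      have h1 : res (G' (u + c)) = 0 := by
        have e1 : res (G' u) = a (s⁻¹ • T u) := by
          rw [map_smul, hT]
          simp [hG', hu]
        rw [map_add, map_add, resG', hc', e1, ← map_add]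
        simp
      rw [← hxy, map_add, hx, zero_add] at h1
      have := inj' ⟨y, hy⟩ h1
      have hy0 : y = 0 := congrArg Subtype.val this
      rw [← hxy, hy0, add_zero, hx]
    have := hf s⁻¹ (inv_ne_zero hs0) heq _ hw
    rw [map_add] at this
    exact eq_neg_of_add_eq_zero_right this
  simpa using key

/-- adding a cyclic subspace. -/
lemma kp_cyclic {N : Type*} [AddCommGroup N] [Module ℂ N]
    (ω : N →ₗ[ℂ] N →ₗ[ℂ] ℂ) (hω : ∀ x y, ω x y = - ω y x) (P : N →ₗ[ℂ] N)
    (hP : ∀ x y, ω (P x) y = ω x (P y)) (U : Submodule ℂ N)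
    (hU : ∀ x ∈ U, ∀ y ∈ U, ω x y = 0) (hPU : ∀ x ∈ U, P x ∈ U)
    (v : N) (hv : ∀ x ∈ U, ω v x = 0) :
    ∃ U' : Submodule ℂ N, U ≤ U' ∧ v ∈ U' ∧ (∀ x ∈ U', ∀ y ∈ U', ω x y = 0) ∧
      ∀ x ∈ U', P x ∈ U' := by
  have hpow : ∀ (i : ℕ) x y, ω ((P ^ i) x) y = ω x ((P ^ i) y) := by
    intro i
    induction i with
    | zero => simp
    | succ i ih =>
      intro x y
      rw [pow_succ, Module.End.mul_apply, ih, hP, ← Module.End.mul_apply,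
        ← pow_succ', pow_succ]
  have hPUi : ∀ (i : ℕ), ∀ x ∈ U, (P ^ i) x ∈ U := by
    intro i
    induction i with
    | zero => simp
    | succ i ih =>
      intro x hx
      rw [pow_succ, Module.End.mul_apply]
      exact ih _ (hPU x hx)
  have hvv : ∀ i : ℕ, ω v ((P ^ i) v) = 0 := by
    intro i
    have h1 := hpow i v v
    have h2 := hω v ((P ^ i) v)
    rw [h1] at h2
    exact self_eq_neg.1 h2
  let S : Set N := (U : Set N) ∪ Set.range (fun i : ℕ => (P ^ i) v)
  refine ⟨Submodule.span ℂ S, ?_, ?_, ?_, ?_⟩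
  · intro x hx
    exact Submodule.subset_span (Or.inl hx)
  · exact Submodule.subset_span (Or.inr ⟨0, by simp⟩)
  · have hS : ∀ x ∈ S, ∀ y ∈ S, ω x y = 0 := by
      rintro x (hx | ⟨i, rfl⟩) y (hy | ⟨j, rfl⟩)
      · exact hU x hx y hy
      · rw [hω]
        simp only [hpow]
        rw [hv _ (hPUi j x hx), neg_zero]
      · simp only [hpow]
        exact hv _ (hPUi i y hy)
      · simp only [hpow]
        rw [← Module.End.mul_apply, ← pow_add]
        exact hvv _
    intro x hx y hy
    induction hx, hy using Submodule.span_induction₂ with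
    | mem_mem x y hx hy => exact hS x hx y hy
    | zero_left y hy => simp
    | zero_right x hx => simp
    | add_left x y z _ _ _ h1 h2 => simp [h1, h2]
    | add_right x y z _ _ _ h1 h2 => simp [h1, h2]
    | smul_left r x y _ _ h => simp [h]
    | smul_right r x y _ _ h => simp [h]
  · intro x hx
    induction hx using Submodule.span_induction with
    | mem x hx =>
      apply Submodule.subset_span
      rcases hx with hx | ⟨i, rfl⟩
      · exact Or.inl (hPU x hx)
      · refine Or.inr ⟨i + 1, ?_⟩
        simp only [pow_succ', Module.End.mul_apply]
    | zero => simp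
    | add x y _ _ h1 h2 => rw [map_add]; exact Submodule.add_mem _ h1 h2
    | smul r x _ h => rw [map_smul]; exact Submodule.smul_mem _ _ h

lemma kp_maximal {N : Type*} [AddCommGroup N] [Module ℂ N] [FiniteDimensional ℂ N]
    (ω : N →ₗ[ℂ] N →ₗ[ℂ] ℂ) (hω : ∀ x y, ω x y = - ω y x) (P : N →ₗ[ℂ] N)
    (hP : ∀ x y, ω (P x) y = ω x (P y)) (U : Submodule ℂ N)
    (hU : ∀ x ∈ U, ∀ y ∈ U, ω x y = 0) (hPU : ∀ x ∈ U, P x ∈ U) :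
    ∃ U' : Submodule ℂ N, U ≤ U' ∧ (∀ x ∈ U', ∀ y ∈ U', ω x y = 0) ∧
      (∀ x ∈ U', P x ∈ U') ∧ ∀ v, (∀ x ∈ U', ω v x = 0) → v ∈ U' := by
  let S : Set (Submodule ℂ N) :=
    {X | U ≤ X ∧ (∀ x ∈ X, ∀ y ∈ X, ω x y = 0) ∧ ∀ x ∈ X, P x ∈ X}
  obtain ⟨X, hX, hmax⟩ := (wellFounded_gt (α := Submodule ℂ N)).has_min S ⟨U, le_rfl, hU, hPU⟩
  refine ⟨X, hX.1, hX.2.1, hX.2.2, fun v hv => ?_⟩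
  obtain ⟨Y, h1, h2, h3, h4⟩ := kp_cyclic ω hω P hP X hX.2.1 hX.2.2 v hv
  by_contra hvX
  exact hmax Y ⟨hX.1.trans h1, h3, h4⟩ (lt_of_le_of_ne h1 (fun e => hvX (e ▸ h2)))

def kpSpan {V : Type*} [AddCommGroup V] [Module ℂ V]
    (A B : V →ₗ[ℂ] V →ₗ[ℂ] ℂ) (k : ℕ) : Submodule ℂ V :=
  Submodule.span ℂ {x | ∃ l : ℂ, finrank ℂ (LinearMap.ker (A + l • B)) = k ∧ (A + l • B) x = 0}

lemma kp_avoid {V : Type*} [AddCommGroup V] [Module ℂ V] [FiniteDimensional ℂ V]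
    (A B : V →ₗ[ℂ] V →ₗ[ℂ] ℂ) (hA : ∀ v w, A v w = - A w v) (hB : ∀ v w, B v w = - B w v)
    (k : ℕ) (hk : ∀ l : ℂ, k ≤ finrank ℂ (LinearMap.ker (A + l • B))) (ν : ℂ) :
    kpSpan A B k = Submodule.span ℂ {x | ∃ l : ℂ, l ≠ ν ∧
      finrank ℂ (LinearMap.ker (A + l • B)) = k ∧ (A + l • B) x = 0} := by
  apply le_antisymm
  · refine Submodule.span_le.2 ?_
    rintro x ⟨l, hl, hx⟩
    by_cases hlν : l = ν
    · subst hlν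
      by_contra hxn
      obtain ⟨f, hfx, hf⟩ := Submodule.exists_le_ker_of_notMem hxn
      apply hfx
      refine kp_limit (A + l • B) B ?_ ?_ x hx f ?_
      · intro v w
        simp only [LinearMap.add_apply, LinearMap.smul_apply]
        rw [hA v w, hB v w]; simp; ring
      · intro ε
        rw [hl, add_assoc, ← add_smul]
        exact hk _
      · intro ε hε h1 w hw
        rw [add_assoc, ← add_smul] at h1 hw
        exact hf (Submodule.subset_span ⟨l + ε, by simpa using hε, h1.trans hl, hw⟩)
    · exact Submodule.subset_span ⟨l, hlν, hl, hx⟩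
  · apply Submodule.span_mono
    rintro x ⟨l, -, hl, hx⟩
    exact ⟨l, hl, hx⟩

lemma kp_W {V : Type*} [AddCommGroup V] [Module ℂ V] [FiniteDimensional ℂ V]
    (A B : V →ₗ[ℂ] V →ₗ[ℂ] ℂ) (hA : ∀ v w, A v w = - A w v) (hB : ∀ v w, B v w = - B w v)
    (k : ℕ) (hk : ∀ l : ℂ, k ≤ finrank ℂ (LinearMap.ker (A + l • B))) (ν : ℂ) :
    (kpSpan A B k).map (A + ν • B) = (kpSpan A B k).map B := by
  rw [kp_avoid A B hA hB k hk ν, Submodule.map_span, Submodule.map_span]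
  have hx' : ∀ (l : ℂ) x, (A + l • B) x = 0 → (A + ν • B) x = (ν - l) • B x := by
    intro l x hx
    have : A x = - (l • B x) := eq_neg_of_add_eq_zero_left (by simpa using hx)
    simp only [LinearMap.add_apply, LinearMap.smul_apply, this, sub_smul]
    abel
  apply le_antisymm
  · refine Submodule.span_le.2 ?_
    rintro _ ⟨x, ⟨l, hlν, hl, hx⟩, rfl⟩
    rw [hx' l x hx]
    exact Submodule.smul_mem _ _ (Submodule.subset_span ⟨x, ⟨l, hlν, hl, hx⟩, rfl⟩)
  · refine Submodule.span_le.2 ?_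
    rintro _ ⟨x, ⟨l, hlν, hl, hx⟩, rfl⟩
    have h0 : ν - l ≠ 0 := sub_ne_zero.2 (Ne.symm hlν)
    have : B x = (ν - l)⁻¹ • (A + ν • B) x := by
      rw [hx' l x hx, smul_smul, inv_mul_cancel₀ h0, one_smul]
    rw [this]
    exact Submodule.smul_mem _ _ (Submodule.subset_span ⟨x, ⟨l, hlν, hl, hx⟩, rfl⟩)

lemma kp_iso {V : Type*} [AddCommGroup V] [Module ℂ V] [FiniteDimensional ℂ V]
    (A B : V →ₗ[ℂ] V →ₗ[ℂ] ℂ) (hA : ∀ v w, A v w = - A w v) (hB : ∀ v w, B v w = - B w v)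
    (k : ℕ) (hk : ∀ l : ℂ, k ≤ finrank ℂ (LinearMap.ker (A + l • B))) :
    ∀ x ∈ kpSpan A B k, ∀ y ∈ kpSpan A B k, B x y = 0 := by
  have h1 : ∀ (l : ℂ) x, (A + l • B) x = 0 → ∀ y ∈ kpSpan A B k, B x y = 0 := by
    intro l x hx y hy
    rw [kp_avoid A B hA hB k hk l] at hy
    induction hy using Submodule.span_induction with
    | mem y hy =>
      obtain ⟨m, hml, -, hy⟩ := hy
      have e1 : A x y + l * B x y = 0 := by simpa using congrArg (fun φ => φ y) hx
      have e2 : A y x + m * B y x = 0 := by simpa using congrArg (fun φ => φ x) hy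
      rw [hA y x, hB y x] at e2
      have e3 : (m - l) * B x y = 0 := by linear_combination - e1 - e2
      exact (mul_eq_zero.1 e3).resolve_left (sub_ne_zero.2 hml)
    | zero => simp
    | add y z _ _ h1 h2 => simp [h1, h2]
    | smul r y _ h => simp [h]
  intro x hx y hy
  unfold kpSpan at hx
  induction hx using Submodule.span_induction with
  | mem x hx =>
    obtain ⟨l, -, hx⟩ := hx
    exact h1 l x hx y hy
  | zero => simp
  | add y z _ _ h1 h2 => simp [h1, h2]
  | smul r y _ h => simp [h]

/-- dimension of the image of a subspace. -/
lemma kp_map_dim {V W : Type*} [AddCommGroup V] [Module ℂ V] [FiniteDimensional ℂ V]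
    [AddCommGroup W] [Module ℂ W]
    (G : V →ₗ[ℂ] W) (U : Submodule ℂ V) :
    finrank ℂ (U.map G) + finrank ℂ (U ⊓ LinearMap.ker G : Submodule ℂ V) = finrank ℂ U := by
  have h := LinearMap.finrank_range_add_finrank_ker (G.domRestrict U)
  rw [LinearMap.range_domRestrict] at h
  have h2 : finrank ℂ (LinearMap.ker (G.domRestrict U))
      = finrank ℂ (U ⊓ LinearMap.ker G : Submodule ℂ V) := by
    rw [LinearMap.ker_domRestrict, ← Submodule.map_comap_subtype]
    exact (LinearEquiv.finrank_eq
      (Submodule.equivMapOfInjective U.subtype U.injective_subtype _))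
  omega

/-- dimension of the orthogonal. -/
lemma kp_orth_dim {V : Type*} [AddCommGroup V] [Module ℂ V] [FiniteDimensional ℂ V]
    (G : V →ₗ[ℂ] V →ₗ[ℂ] ℂ) (U : Submodule ℂ V) (hU : LinearMap.ker G ≤ U) :
    finrank ℂ (Submodule.dualCoannihilator (U.map G)) + finrank ℂ U
      = finrank ℂ V + finrank ℂ (LinearMap.ker G) := by
  have h1 := kp_map_dim G U
  rw [inf_eq_right.2 hU] at h1
  have h2 : finrank ℂ (U.map G) + finrank ℂ (Submodule.dualCoannihilator (U.map G))
      = finrank ℂ V := Subspace.finrank_add_finrank_dualCoannihilator_eq (U.map G)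
  omega

lemma kp_mem_orth {V : Type*} [AddCommGroup V] [Module ℂ V]
    (G : V →ₗ[ℂ] V →ₗ[ℂ] ℂ) (U : Submodule ℂ V) (v : V) :
    v ∈ Submodule.dualCoannihilator (U.map G) ↔ ∀ x ∈ U, G x v = 0 := by
  rw [Submodule.mem_dualCoannihilator]
  constructor
  · intro h x hx
    exact h _ ⟨x, hx, rfl⟩
  · rintro h _ ⟨x, hx, rfl⟩
    exact h x hx

/-- An isotropic subspace of the maximal dimension contains the kernel. -/
lemma kp_ker_le {V : Type*} [AddCommGroup V] [Module ℂ V] [FiniteDimensional ℂ V]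
    (G : V →ₗ[ℂ] V →ₗ[ℂ] ℂ) (hG : ∀ v w, G v w = - G w v) (U : Submodule ℂ V)
    (hU : ∀ x ∈ U, ∀ y ∈ U, G x y = 0)
    (hd : 2 * finrank ℂ U = finrank ℂ V + finrank ℂ (LinearMap.ker G)) :
    LinearMap.ker G ≤ U := by
  have h1 := kp_orth_dim G (U ⊔ LinearMap.ker G) le_sup_right
  have h2 : U ⊔ LinearMap.ker G ≤
      Submodule.dualCoannihilator ((U ⊔ LinearMap.ker G).map G) := by
    intro v hv
    rw [kp_mem_orth]
    intro x hx
    obtain ⟨a, ha, b, hb, rfl⟩ := Submodule.mem_sup.1 hv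
    obtain ⟨c, hc, d, hd, rfl⟩ := Submodule.mem_sup.1 hx
    have hb : G b = 0 := hb
    have hd : G d = 0 := hd
    rw [map_add G c d, hd, add_zero, map_add, hU c hc a ha, hG c b, hb]
    simp
  have h3 := Submodule.finrank_mono h2
  have h4 : finrank ℂ (U ⊔ LinearMap.ker G : Submodule ℂ V) ≤ finrank ℂ U := by omega
  have h5 : U = U ⊔ LinearMap.ker G :=
    Submodule.eq_of_le_of_finrank_le le_sup_left h4
  rw [h5]
  exact le_sup_right

/-- Core facts. -/
lemma kp_core {V : Type*} [AddCommGroup V] [Module ℂ V] [FiniteDimensional ℂ V]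
    (A B : V →ₗ[ℂ] V →ₗ[ℂ] ℂ) (hA : ∀ v w, A v w = - A w v) (hB : ∀ v w, B v w = - B w v)
    (k : ℕ) (hk : ∀ l : ℂ, k ≤ finrank ℂ (LinearMap.ker (A + l • B)))
    (μ : ℂ) (hμ : finrank ℂ (LinearMap.ker (A + μ • B)) = k)
    (L : Submodule ℂ V) (hL : L = kpSpan A B k) :
    ((finrank ℂ (LinearMap.ker B) = k ∧ ∀ l : ℂ, finrank ℂ (LinearMap.ker (A + l • B)) = k) ↔
      2 * finrank ℂ L = finrank ℂ V + k) ∧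
    (2 * finrank ℂ L = finrank ℂ V + k ↔
      ∃! U : Submodule ℂ V, (∀ u ∈ U, ∀ u' ∈ U, A u u' = 0 ∧ B u u' = 0) ∧
        2 * finrank ℂ U = finrank ℂ V + k) := by
  have hW : ∀ ν : ℂ, L.map (A + ν • B) = L.map B := by
    subst hL; exact kp_W A B hA hB k hk
  have isoB : ∀ x ∈ L, ∀ y ∈ L, B x y = 0 := by
    subst hL; exact kp_iso A B hA hB k hk
  have kerL : ∀ l : ℂ, finrank ℂ (LinearMap.ker (A + l • B)) = k →
      LinearMap.ker (A + l • B) ≤ L := by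
    intro l hl x hx
    rw [hL]
    exact Submodule.subset_span ⟨l, hl, hx⟩
  have skew : ∀ (l : ℂ) v w, (A + l • B) v w = - (A + l • B) w v := by
    intro l v w
    simp only [LinearMap.add_apply, LinearMap.smul_apply]
    rw [hA v w, hB v w]; simp; ring
  set M : Submodule ℂ V := Submodule.dualCoannihilator (L.map B) with hM
  have hM' : ∀ l : ℂ, M = Submodule.dualCoannihilator (L.map (A + l • B)) := by
    intro l; rw [hM, hW]
  have memM : ∀ v, v ∈ M ↔ ∀ x ∈ L, B x v = 0 := kp_mem_orth B L
  have memM' : ∀ (l : ℂ) v, v ∈ M ↔ ∀ x ∈ L, (A + l • B) x v = 0 := by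
    intro l v; rw [hM' l]; exact kp_mem_orth _ L v
  have LM : L ≤ M := fun v hv => (memM v).2 fun x hx => isoB x hx v hv
  have dimM : finrank ℂ M + finrank ℂ L = finrank ℂ V + k := by
    have := kp_orth_dim (A + μ • B) L (kerL μ hμ)
    rwa [hμ, ← hM' μ] at this
  have dimLM := Submodule.finrank_mono LM
  have dimW : finrank ℂ (L.map B) + k = finrank ℂ L := by
    have := kp_map_dim (A + μ • B) L
    rwa [inf_eq_right.2 (kerL μ hμ), hμ, hW] at this
  have isoG : ∀ (l : ℂ), ∀ x ∈ L, ∀ y ∈ L, (A + l • B) x y = 0 :=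
    fun l x hx y hy => (memM' l y).1 (LM hy) x hx
  have isoA : ∀ x ∈ L, ∀ y ∈ L, A x y = 0 := by
    intro x hx y hy
    simpa using isoG 0 x hx y hy
  -- the recursion operator
  set G := A + μ • B with hG
  have rangeM : M.map G = L.dualAnnihilator := by
    apply Submodule.eq_of_le_of_finrank_le
    · rintro _ ⟨v, hv, rfl⟩
      rw [Submodule.mem_dualAnnihilator]
      intro x hx
      rw [skew, (memM' μ v).1 hv x hx, neg_zero]
    · have h1 := kp_map_dim G M
      rw [inf_eq_right.2 ((kerL μ hμ).trans LM), hμ] at h1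
      have h2 : finrank ℂ L + finrank ℂ L.dualAnnihilator = finrank ℂ V :=
        Subspace.finrank_add_finrank_dualAnnihilator_eq L
      have h3 : finrank ℂ L.dualAnnihilator ≤ finrank ℂ (M.map G) := by omega
      exact h3
  obtain ⟨P, hP⟩ : ∃ P : M →ₗ[ℂ] M, ∀ v : M, G (P v) = B v := by
    let g : M →ₗ[ℂ] L.dualAnnihilator :=
      (G ∘ₗ M.subtype).codRestrict _ (fun v => rangeM ▸ ⟨v, v.2, rfl⟩)
    have hg : Function.Surjective g := by
      rintro ⟨φ, hφ⟩
      rw [← rangeM] at hφ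
      obtain ⟨v, hv, rfl⟩ := hφ
      exact ⟨⟨v, hv⟩, rfl⟩
    let b : M →ₗ[ℂ] L.dualAnnihilator :=
      (B ∘ₗ M.subtype).codRestrict _ (fun v => by
        rw [Submodule.mem_dualAnnihilator]
        intro x hx
        have := (memM v).1 v.2 x hx
        simp [hB v x, this])
    obtain ⟨P, hP⟩ := Module.projective_lifting_property g b hg
    refine ⟨P, fun v => ?_⟩
    have := congrArg (fun h => ((h v : L.dualAnnihilator) : V →ₗ[ℂ] ℂ)) hP
    exact this
  let ω : M →ₗ[ℂ] M →ₗ[ℂ] ℂ := G.domRestrict₁₂ M M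
  have hω : ∀ x y : M, ω x y = G x y := fun x y => rfl
  have ωskew : ∀ x y, ω x y = - ω y x := fun x y => skew μ x y
  have ωP : ∀ x y, ω (P x) y = ω x (P y) := by
    intro x y
    rw [ωskew x, hω, hω, hP, hP, hB]
  let L' : Submodule ℂ M := L.comap M.subtype
  have hL'iso : ∀ x ∈ L', ∀ y ∈ L', ω x y = 0 := fun x hx y hy => isoG μ x hx y hy
  have hL'P : ∀ x ∈ L', P x ∈ L' := by
    intro x hx
    have h1 : B x ∈ L.map G := by rw [hG, hW]; exact ⟨x, hx, rfl⟩
    obtain ⟨y, hy, hyx⟩ := h1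
    have h2 : ((P x : M) : V) - y ∈ L := kerL μ hμ (by
      rw [LinearMap.mem_ker, map_sub, hP, hyx, sub_self])
    have := L.add_mem h2 hy
    rw [sub_add_cancel] at this
    exact this
  have hLle : ∀ U : Submodule ℂ V, (∀ u ∈ U, ∀ u' ∈ U, A u u' = 0 ∧ B u u' = 0) →
        2 * finrank ℂ U = finrank ℂ V + k → L ≤ U := by
    intro U h1 h2
    rw [hL]
    refine Submodule.span_le.2 ?_
    rintro x ⟨l, hl, hx⟩
    refine kp_ker_le (A + l • B) (skew l) U ?_ (by rw [hl, h2]) hx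
    intro u hu u' hu'
    simp [h1 u hu u' hu']
  refine ⟨⟨?_, ?_⟩, ⟨?_, ?_⟩⟩
  · rintro ⟨hBk, hAk⟩
    have kerB : LinearMap.ker B ≤ L := by
      have h1 := kp_map_dim B L
      have h2 : L ⊓ LinearMap.ker B = LinearMap.ker B :=
        Submodule.eq_of_le_of_finrank_le inf_le_right (by omega)
      exact inf_eq_right.1 h2
    have hML : M ≤ L := by
      by_contra hne
      have hL'top : L' ≠ ⊤ := by
        intro h
        apply hne
        intro x hx
        have : (⟨x, hx⟩ : M) ∈ L' := by rw [h]; trivial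
        exact this
      let Q : (M ⧸ L') →ₗ[ℂ] (M ⧸ L') := L'.mapQ L' P hL'P
      have : Nontrivial (M ⧸ L') := Submodule.Quotient.nontrivial_iff.2 hL'top
      obtain ⟨α, hα⟩ := Module.End.exists_eigenvalue Q
      obtain ⟨q, hq⟩ := hα.exists_hasEigenvector
      obtain ⟨v, rfl⟩ := L'.mkQ_surjective q
      have hq1 := hq.apply_eq_smul
      have hq2 := hq.2
      have hvL : (v : V) ∉ L := by
        intro h
        apply hq2
        rw [Submodule.mkQ_apply, Submodule.Quotient.mk_eq_zero]
        exact h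
      have hmem : P v - α • v ∈ L' := by
        rw [← Submodule.Quotient.mk_eq_zero, Submodule.Quotient.mk_sub,
          Submodule.Quotient.mk_smul, sub_eq_zero]
        exact hq1
      have hmem' : G ((P v : M) - α • (v : V)) ∈ L.map B := by
        rw [← hW μ]; exact ⟨_, hmem, rfl⟩
      rw [map_sub, hP, map_smul] at hmem'
      by_cases hα0 : α = 0
      · rw [hα0, zero_smul, sub_zero] at hmem'
        obtain ⟨y, hy, hyv⟩ := hmem'
        have : (v : V) - y ∈ L := kerB (by rw [LinearMap.mem_ker, map_sub, hyv, sub_self])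
        apply hvL
        have := L.add_mem this hy
        rwa [sub_add_cancel] at this
      · have h3 : (A + (μ - α⁻¹) • B) (v : V) = (-α⁻¹) • (B v - α • G v) := by
          rw [smul_sub, smul_smul, hG]
          simp only [LinearMap.add_apply, LinearMap.smul_apply]
          rw [neg_mul, inv_mul_cancel₀ hα0]
          module
        have h4 : (A + (μ - α⁻¹) • B) (v : V) ∈ L.map (A + (μ - α⁻¹) • B) := by
          rw [hW, h3]; exact Submodule.smul_mem _ _ hmem'
        obtain ⟨y, hy, hyv⟩ := h4
        have : (v : V) - y ∈ L := kerL _ (hAk (μ - α⁻¹))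
          (by rw [LinearMap.mem_ker, map_sub, hyv, sub_self])
        apply hvL
        have := L.add_mem this hy
        rwa [sub_add_cancel] at this
    have := Submodule.finrank_mono hML
    omega
  · intro h
    have hLM : L = M := Submodule.eq_of_le_of_finrank_le LM (by omega)
    have aux : ∀ C : V →ₗ[ℂ] V →ₗ[ℂ] ℂ, (∀ v w, C v w = - C w v) → L.map C = L.map B →
        finrank ℂ (LinearMap.ker C) = k := by
      intro C hC hCW
      have h1 : LinearMap.ker C ≤ L := by
        intro v hv
        have hv : C v = 0 := hv
        rw [hLM, hM, ← hCW, kp_mem_orth]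
        intro x _
        rw [hC, hv]; simp
      have h2 := kp_map_dim C L
      rw [inf_eq_right.2 h1, hCW] at h2
      omega
    exact ⟨aux B hB rfl, fun l => aux _ (skew l) (hW l)⟩
  · intro h
    refine ⟨L, ⟨fun u hu u' hu' => ⟨isoA u hu u' hu', isoB u hu u' hu'⟩, h⟩, ?_⟩
    rintro U ⟨h1, h2⟩
    exact (Submodule.eq_of_le_of_finrank_le (hLle U h1 h2) (by omega)).symm
  · rintro ⟨U, ⟨hU1, hU2⟩, huniq⟩
    have hMU : M ≤ U := by
      intro v hv
      obtain ⟨X, hX1, hX2, hX3, hX4⟩ := kp_cyclic ω ωskew P ωP L' hL'iso hL'P ⟨v, hv⟩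
        (fun x hx => by
          rw [ωskew, hω, (memM' μ v).1 hv x hx, neg_zero])
      obtain ⟨Y, hY1, hY2, hY3, hY4⟩ := kp_maximal ω ωskew P ωP X hX3 hX4
      have hLY : L ≤ Y.map M.subtype := by
        intro x hx
        exact ⟨⟨x, LM hx⟩, hY1 (hX1 hx), rfl⟩
      have hYo : Submodule.dualCoannihilator ((Y.map M.subtype).map G) = Y.map M.subtype := by
        ext x
        rw [kp_mem_orth]
        constructor
        · intro h
          have hxM : x ∈ M := (memM' μ x).2 (fun y hy => h y (hLY hy))
          refine ⟨⟨x, hxM⟩, hY4 _ ?_, rfl⟩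
          intro y hy
          have h5 : G (y : V) x = 0 := h _ ⟨y, hy, rfl⟩
          rw [ωskew, hω, h5, neg_zero]
        · rintro ⟨y, hy, rfl⟩ _ ⟨z, hz, rfl⟩
          exact hY2 z hz y hy
      have hd := kp_orth_dim G (Y.map M.subtype) ((kerL μ hμ).trans hLY)
      rw [hYo, hμ] at hd
      have hYU : Y.map M.subtype = U := by
        refine huniq _ ⟨?_, by omega⟩
        rintro _ ⟨y, hy, rfl⟩ _ ⟨z, hz, rfl⟩
        have e1 : B y z = 0 := by
          rw [← hP]
          exact hY2 _ (hY3 y hy) z hz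
        have e2 : G y z = 0 := hY2 y hy z hz
        refine ⟨?_, e1⟩
        simpa [hG, e1] using e2
      rw [← hYU]
      exact ⟨⟨v, hv⟩, hY1 hX2, rfl⟩
    have h1 := Submodule.finrank_mono hMU
    have h2 := Submodule.finrank_mono (hLle U hU1 hU2)
    omega

/-- Characterisation of Kronecker pencils. The following are equivalent:
(1) `rank B = r` and `rank (A + λB) = r` for every `λ ∈ ℂ`;
(2) `2 · dim L = 2 · dim V − r`, i.e. `L` (the span of the kernels of the regular forms)
is bi-Lagrangian;
(3) `V` has exactly one bi-Lagrangian subspace. -/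
theorem kronecker_pencil_characterisation
    (V : Type*) [AddCommGroup V] [Module ℂ V] [FiniteDimensional ℂ V]
    (A B : V →ₗ[ℂ] V →ₗ[ℂ] ℂ)
    (hA : ∀ v : V, A v v = 0) (hB : ∀ v : V, B v v = 0)
    (r : ℕ)
    (hr_le : ∀ l : ℂ, formRank (A + l • B) ≤ r)
    (hr_ex : ∃ l : ℂ, formRank (A + l • B) = r)
    (L : Submodule ℂ V)
    (hL : L = Submodule.span ℂ
      (⋃ l ∈ {l : ℂ | formRank (A + l • B) = r}, (LinearMap.ker (A + l • B) : Set V))) :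
    ((formRank B = r ∧ ∀ l : ℂ, formRank (A + l • B) = r) ↔
        2 * Module.finrank ℂ L = 2 * Module.finrank ℂ V - r) ∧
    ((formRank B = r ∧ ∀ l : ℂ, formRank (A + l • B) = r) ↔
        ∃! U : Submodule ℂ V, IsBiLagrangian A B r U) := by
  obtain ⟨μ, hμ⟩ := hr_ex
  set k := Module.finrank ℂ (LinearMap.ker (A + μ • B)) with hk
  have hle : ∀ C : V →ₗ[ℂ] V →ₗ[ℂ] ℂ,
      Module.finrank ℂ (LinearMap.ker C) ≤ Module.finrank ℂ V :=
    fun C => Submodule.finrank_le _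
  have hrk : r + k = Module.finrank ℂ V := by
    have := hle (A + μ • B)
    unfold formRank at hμ
    omega
  have hiff : ∀ C : V →ₗ[ℂ] V →ₗ[ℂ] ℂ,
      formRank C = r ↔ Module.finrank ℂ (LinearMap.ker C) = k := by
    intro C
    have := hle C
    unfold formRank
    omega
  have skewOf : ∀ C : V →ₗ[ℂ] V →ₗ[ℂ] ℂ, (∀ v, C v v = 0) → ∀ v w, C v w = - C w v := by
    intro C hC v w
    have h := hC (v + w)
    simp only [map_add, LinearMap.add_apply, hC, zero_add, add_zero] at h
    linear_combination h
  have hsub : 2 * Module.finrank ℂ V - r = Module.finrank ℂ V + k := by omega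
  have hL' : L = kpSpan A B k := by
    rw [hL, kpSpan]
    congr 1
    ext x
    simp [hiff]
  have core := kp_core A B (skewOf A hA) (skewOf B hB) k (fun l => by
    have h1 := hr_le l
    have h2 := hle (A + l • B)
    unfold formRank at h1
    omega) μ hk.symm L hL'
  unfold IsBiLagrangian
  simp only [hiff, hsub]
  exact ⟨core.1, core.1.trans core.2⟩
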